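/- Let p ≥ 1, t ∈ (0,1), and α ∈ (-∞,1]. Let K = ⋃_{i=1}^m [a_i,b_i] ⊂ ℝ_+ and L = ⋃_{j=1}^ν [c_j,d_j] ⊂ ℝ_+ be finite unions of compact intervals with nonnegative endpoints, where the intervals comprising K have mutually disjoint interiors and likewise for L. Then V_1((1-t) ×_{p,α} K +_{p,α} t ×_{p,α} L) ≥ M_{pα}^t(V_1(K), V_1(L)), where the one-dimensional L_{p,α}-curvilinear combination is (1-t) ×_{p,α} K +_{p,α} t ×_{p,α} L := ⋃_{0<λ<1} { M_{p,α}^{(t,λ)}(a,b) : a ∈ K, b ∈ L }. -/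

import Mathlib

open MeasureTheory Set Filter
open scoped ENNReal Topology Classical

/-- The `L_p` coefficient `C_{p,λ,t} = (1-t)^{1/p} (1-λ)^{1/q}` (with `1/q = 1 - 1/p`). -/
noncomputable def Cc (p t l : ℝ) : ℝ := (1 - t) ^ (1/p) * (1 - l) ^ (1 - 1/p)

/-- The `L_p` coefficient `D_{p,λ,t} = t^{1/p} λ^{1/q}` (with `1/q = 1 - 1/p`). -/
noncomputable def Dd (p t l : ℝ) : ℝ := t ^ (1/p) * l ^ (1 - 1/p)

/-- The `L_p` `α`-mean `M_{p,α}^{(t,λ)}(a,b)` for finite `α`. -/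
noncomputable def Mp (p t l α a b : ℝ) : ℝ :=
  if a * b = 0 then 0
  else if α = 0 then a ^ Cc p t l * b ^ Dd p t l
  else (Cc p t l * a ^ α + Dd p t l * b ^ α) ^ (1/α)

/-- The classical `α`-mean `M_α^t(a,b)` for finite `α`. -/
noncomputable def Mmean (t α a b : ℝ) : ℝ :=
  if a * b = 0 then 0
  else if α = 0 then a ^ (1-t) * b ^ t
  else ((1-t) * a ^ α + t * b ^ α) ^ (1/α)

/-- One-dimensional `L_{p,α}`-curvilinear combination of `K, L ⊆ ℝ`. -/
def curv1 (p t α : ℝ) (K L : Set ℝ) : Set ℝ :=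
  ⋃ l ∈ Set.Ioo (0:ℝ) 1, {z | ∃ a ∈ K, ∃ b ∈ L, z = Mp p t l α a b}

/-- Two-variable power mean with weights `A`, `B` that need not add up to one. -/
noncomputable def weightedMean (A B α x y : ℝ) : ℝ :=
  if α = 0 then x ^ A * y ^ B else (A * x ^ α + B * y ^ α) ^ (1 / α)

section WeightedMean

variable {A B α x y u v : ℝ}

lemma weightedMean_pos (hA : 0 < A) (hB : 0 < B) (hx : 0 < x) (hy : 0 < y) :
    0 < weightedMean A B α x y := by
  unfold weightedMean
  split_ifs <;> positivity

lemma weightedMean_mono (hA : 0 < A) (hB : 0 < B) (hx : 0 < x) (hy : 0 < y)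
    (hxu : x ≤ u) (hyv : y ≤ v) : weightedMean A B α x y ≤ weightedMean A B α u v := by
  have hu : 0 < u := hx.trans_le hxu
  have hv : 0 < v := hy.trans_le hyv
  unfold weightedMean
  split_ifs with h
  · gcongr
  · rcases lt_or_gt_of_ne h with h | h
    · have h1 := Real.rpow_le_rpow_of_nonpos hx hxu h.le
      have h2 := Real.rpow_le_rpow_of_nonpos hy hyv h.le
      apply Real.rpow_le_rpow_of_nonpos (by positivity) (by gcongr)
      exact one_div_nonpos.2 h.le
    · gcongr

lemma weightedMean_smul (hA : 0 < A) (hB : 0 < B) (hx : 0 < x) (hy : 0 < y)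
    (h0 : α = 0 → A + B = 1) {r : ℝ} (hr : 0 < r) :
    weightedMean A B α (x * r) (y * r) = weightedMean A B α x y * r := by
  unfold weightedMean
  split_ifs with h
  · rw [Real.mul_rpow hx.le hr.le, Real.mul_rpow hy.le hr.le]
    have : r ^ A * r ^ B = r := by rw [← Real.rpow_add hr, h0 h, Real.rpow_one]
    linear_combination (x ^ A * y ^ B) * this
  · rw [Real.mul_rpow hx.le hr.le, Real.mul_rpow hy.le hr.le,
      show A * (x ^ α * r ^ α) + B * (y ^ α * r ^ α) = (A * x ^ α + B * y ^ α) * r ^ α by ring,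
      Real.mul_rpow (by positivity) (by positivity), ← Real.rpow_mul hr.le, mul_one_div_cancel h,
      Real.rpow_one]

lemma rpow_add_le_of_neg {w₁ w₂ : ℝ} (hα : α < 0) (hx : 0 < x) (hy : 0 < y)
    (h₁ : 0 ≤ w₁) (h₂ : 0 ≤ w₂) (h : w₁ + w₂ = 1) :
    (w₁ * x + w₂ * y) ^ α ≤ w₁ * x ^ α + w₂ * y ^ α := by
  calc (w₁ * x + w₂ * y) ^ α ≤ (x ^ w₁ * y ^ w₂) ^ α :=
        Real.rpow_le_rpow_of_nonpos (by positivity)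
          (Real.geom_mean_le_arith_mean2_weighted h₁ h₂ hx.le hy.le h) hα.le
    _ = (x ^ α) ^ w₁ * (y ^ α) ^ w₂ := by
        rw [Real.mul_rpow (by positivity) (by positivity), ← Real.rpow_mul hx.le,
          ← Real.rpow_mul hy.le, ← Real.rpow_mul hx.le, ← Real.rpow_mul hy.le,
          mul_comm w₁, mul_comm w₂]
    _ ≤ _ := Real.geom_mean_le_arith_mean2_weighted h₁ h₂ (by positivity) (by positivity) h

/-- Reverse Minkowski inequality: the mean of exponent `α ≤ 1` is superadditive. -/
lemma weightedMean_add_le (hA : 0 < A) (hB : 0 < B) (hα : α ≤ 1) (h0 : α = 0 → A + B = 1)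
    (hx : 0 < x) (hy : 0 < y) (hu : 0 < u) (hv : 0 < v) :
    weightedMean A B α x y + weightedMean A B α u v ≤ weightedMean A B α (x + u) (y + v) := by
  rcases eq_or_ne α 0 with h | h
  · simp only [weightedMean, if_pos h]
    have hAB := h0 h
    have e1 := Real.geom_mean_le_arith_mean2_weighted hA.le hB.le
      (show 0 ≤ x / (x + u) by positivity) (show 0 ≤ y / (y + v) by positivity) hAB
    have e2 := Real.geom_mean_le_arith_mean2_weighted hA.le hB.le
      (show 0 ≤ u / (x + u) by positivity) (show 0 ≤ v / (y + v) by positivity) hAB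
    rw [Real.div_rpow (by positivity) (by positivity),
      Real.div_rpow (by positivity) (by positivity)] at e1 e2
    have e3 : A * (x / (x + u)) + B * (y / (y + v)) + (A * (u / (x + u)) + B * (v / (y + v)))
        = 1 := by
      rw [← hAB]; field_simp; ring
    have e4 : (x ^ A * y ^ B + u ^ A * v ^ B) / ((x + u) ^ A * (y + v) ^ B) ≤ 1 := by
      rw [← e3]
      refine le_trans (le_of_eq ?_) (add_le_add e1 e2)
      field_simp
    rwa [div_le_one (by positivity)] at e4
  · have hZ := weightedMean_pos (α := α) hA hB hx hy
    have hW := weightedMean_pos (α := α) hA hB hu hv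
    have hZα : weightedMean A B α x y ^ α = A * x ^ α + B * y ^ α := by
      rw [weightedMean, if_neg h, ← Real.rpow_mul (by positivity), one_div_mul_cancel h,
        Real.rpow_one]
    have hWα : weightedMean A B α u v ^ α = A * u ^ α + B * v ^ α := by
      rw [weightedMean, if_neg h, ← Real.rpow_mul (by positivity), one_div_mul_cancel h,
        Real.rpow_one]
    set Z := weightedMean A B α x y
    set W := weightedMean A B α u v
    have hs : Z / (Z + W) + W / (Z + W) = 1 := by field_simp
    have hsplit (r s : ℝ) :
        r + s = (Z + W) * (Z / (Z + W) * (r / Z) + W / (Z + W) * (s / W)) := by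
      field_simp
    have hsum : A * (Z / (Z + W) * (x / Z) ^ α + W / (Z + W) * (u / W) ^ α) +
        B * (Z / (Z + W) * (y / Z) ^ α + W / (Z + W) * (v / W) ^ α) = 1 := by
      rw [Real.div_rpow hx.le hZ.le, Real.div_rpow hy.le hZ.le, Real.div_rpow hu.le hW.le,
        Real.div_rpow hv.le hW.le]
      have e1 : A * (x ^ α / Z ^ α) + B * (y ^ α / Z ^ α) = 1 := by
        rw [hZα]; field_simp
      have e2 : A * (u ^ α / W ^ α) + B * (v ^ α / W ^ α) = 1 := by
        rw [hWα]; field_simp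
      linear_combination (Z / (Z + W)) * e1 + (W / (Z + W)) * e2 + hs
    have key : Z + W = ((Z + W) ^ α) ^ (1 / α) := by
      rw [← Real.rpow_mul (by positivity), mul_one_div_cancel h, Real.rpow_one]
    rw [key, weightedMean, if_neg h]
    rcases lt_or_gt_of_ne h with h | h
    · refine Real.rpow_le_rpow_of_nonpos (by positivity) ?_ (one_div_nonpos.2 h.le)
      have e1 := rpow_add_le_of_neg h (div_pos hx hZ) (div_pos hu hW)
        (show 0 ≤ Z / (Z + W) by positivity) (by positivity) hs
      have e2 := rpow_add_le_of_neg h (div_pos hy hZ) (div_pos hv hW)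
        (show 0 ≤ Z / (Z + W) by positivity) (by positivity) hs
      rw [hsplit x u, hsplit y v, Real.mul_rpow (by positivity) (by positivity),
        Real.mul_rpow (by positivity) (by positivity)]
      have e3 := add_le_add (mul_le_mul_of_nonneg_left e1 hA.le)
        (mul_le_mul_of_nonneg_left e2 hB.le)
      rw [hsum] at e3
      have := mul_le_mul_of_nonneg_left e3 (show 0 ≤ (Z + W) ^ α by positivity)
      linarith
    · refine Real.rpow_le_rpow (by positivity) ?_ (by positivity)
      have conc := (Real.concaveOn_rpow h.le hα).2
      have e1 := conc (mem_Ici.2 (div_pos hx hZ).le) (mem_Ici.2 (div_pos hu hW).le)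
        (show 0 ≤ Z / (Z + W) by positivity) (by positivity) hs
      have e2 := conc (mem_Ici.2 (div_pos hy hZ).le) (mem_Ici.2 (div_pos hv hW).le)
        (show 0 ≤ Z / (Z + W) by positivity) (by positivity) hs
      simp only [smul_eq_mul] at e1 e2
      rw [hsplit x u, hsplit y v, Real.mul_rpow (by positivity) (by positivity),
        Real.mul_rpow (by positivity) (by positivity)]
      have e3 := add_le_add (mul_le_mul_of_nonneg_left e1 hA.le)
        (mul_le_mul_of_nonneg_left e2 hB.le)
      rw [hsum] at e3
      have := mul_le_mul_of_nonneg_left e3 (show 0 ≤ (Z + W) ^ α by positivity)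
      linarith

end WeightedMean

/-- A set containing the image of `(0, 1]` under a map that expands distances by at least `M`
has measure at least `M`. -/
lemma ofReal_le_volume_of_expanding {S : Set ℝ} {z : ℝ → ℝ} {M : ℝ} (hM : 0 < M)
    (hz : ∀ s ∈ Ioc (0 : ℝ) 1, ∀ s' ∈ Ioc (0 : ℝ) 1, s < s' → z s + M * (s' - s) ≤ z s')
    (hS : ∀ s ∈ Ioc (0 : ℝ) 1, z s ∈ S) : ENNReal.ofReal M ≤ volume S := by
  have habs : ∀ s ∈ Ioc (0 : ℝ) 1, ∀ s' ∈ Ioc (0 : ℝ) 1, M * |s - s'| ≤ |z s - z s'| := by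
    intro s hs s' hs'
    rcases lt_trichotomy s s' with h | h | h
    · have := hz s hs s' hs' h
      rw [abs_sub_comm s, abs_sub_comm (z s), abs_of_pos (sub_pos.2 h)]
      exact le_trans (by linarith) (le_abs_self _)
    · simp [h]
    · have := hz s' hs' s hs h
      rw [abs_of_pos (sub_pos.2 h)]
      exact le_trans (by linarith) (le_abs_self _)
  have hinj : InjOn z (Ioc 0 1) := by
    intro s hs s' hs' h
    have := habs s hs s' hs'
    rw [h, sub_self, abs_zero] at this
    have h2 : |s - s'| ≤ 0 := by nlinarith [abs_nonneg (s - s')]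
    exact sub_eq_zero.1 (abs_nonpos_iff.1 h2)
  have hlip : LipschitzOnWith (Real.toNNReal M⁻¹) (Function.invFunOn z (Ioc 0 1))
      (z '' Ioc 0 1) := by
    apply LipschitzOnWith.of_dist_le_mul
    rintro _ ⟨s, hs, rfl⟩ _ ⟨s', hs', rfl⟩
    rw [hinj.leftInvOn_invFunOn hs, hinj.leftInvOn_invFunOn hs', Real.dist_eq, Real.dist_eq,
      Real.coe_toNNReal _ (by positivity), inv_mul_eq_div, le_div_iff₀ hM, mul_comm]
    exact habs s hs s' hs'
  have h := hlip.hausdorffMeasure_image_le zero_le_one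
  rw [hinj.invFunOn_image Subset.rfl, hausdorffMeasure_real, ENNReal.rpow_one,
    Real.volume_Ioc, sub_zero, ENNReal.ofReal_one] at h
  have hle : volume (z '' Ioc 0 1) ≤ volume S := measure_mono (image_subset_iff.2 hS)
  calc ENNReal.ofReal M = ENNReal.ofReal M * 1 := (mul_one _).symm
    _ ≤ ENNReal.ofReal M * (ENNReal.ofReal M⁻¹ * volume (z '' Ioc 0 1)) := by gcongr; exact h
    _ = volume (z '' Ioc 0 1) := by
      rw [← mul_assoc, ← ENNReal.ofReal_mul hM.le, mul_inv_cancel₀ hM.ne', ENNReal.ofReal_one,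
        one_mul]
    _ ≤ volume S := hle

/-- A quantile function of a compact subset of the half-line. -/
lemma exists_expanding_parametrization {K : Set ℝ} (hK : IsCompact K) (hK0 : K ⊆ Ici 0)
    (hpos : 0 < volume.real K) :
    ∃ x : ℝ → ℝ, (∀ s ∈ Ioc (0 : ℝ) 1, x s ∈ K) ∧
      (∀ s ∈ Ioc (0 : ℝ) 1, volume.real K * s ≤ x s) ∧
      ∀ s ∈ Ioc (0 : ℝ) 1, ∀ s' ∈ Ioc (0 : ℝ) 1, s < s' →
        x s + volume.real K * (s' - s) ≤ x s' := by
  set k := volume.real K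
  set F : ℝ → ℝ := fun r ↦ volume.real (K ∩ Icc 0 r) with hF
  have hfin (r : ℝ) : volume (K ∩ Icc 0 r) ≠ ⊤ :=
    ((measure_mono inter_subset_left).trans_lt hK.measure_lt_top).ne
  have hmono : Monotone F := fun r r' h ↦
    measureReal_mono (inter_subset_inter_right _ (Icc_subset_Icc_right h)) (hfin r')
  have hstep (r r' : ℝ) (h : r ≤ r') : F r' ≤ F r + (r' - r) := by
    have hsub : K ∩ Icc 0 r' ⊆ (K ∩ Icc 0 r) ∪ Ioc r r' := by
      rintro y ⟨hy, hy0, hyr⟩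
      rcases le_or_gt y r with h' | h'
      · exact Or.inl ⟨hy, hy0, h'⟩
      · exact Or.inr ⟨h', hyr⟩
    calc F r' ≤ volume.real ((K ∩ Icc 0 r) ∪ Ioc r r') :=
          measureReal_mono hsub (measure_union_ne_top (hfin r) (by simp))
      _ ≤ F r + volume.real (Ioc r r') := measureReal_union_le _ _
      _ = F r + (r' - r) := by rw [Real.volume_real_Ioc_of_le h]
  have hF0 : F 0 = 0 := by
    have : F 0 ≤ volume.real (Icc (0 : ℝ) 0) := measureReal_mono inter_subset_right (by simp)
    rw [Real.volume_real_Icc_of_le le_rfl, sub_zero] at this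
    exact le_antisymm this measureReal_nonneg
  have hcont : Continuous F := by
    have : LipschitzWith 1 F := by
      apply LipschitzWith.of_le_add
      intro r r'
      rcases le_total r r' with h | h
      · exact (hmono h).trans (by simp)
      · rw [Real.dist_eq, abs_of_nonneg (sub_nonneg.2 h)]
        exact hstep _ _ h
    exact this.continuous
  obtain ⟨R, hR⟩ := hK.bddAbove
  have hFR : F (max R 0) = k := by
    simp only [hF, k]
    congr 1
    exact inter_eq_left.2 fun y hy ↦ ⟨hK0 hy, (hR hy).trans (le_max_left _ _)⟩
  have hex : ∀ s : ℝ, ∃ x, s ∈ Ioc (0 : ℝ) 1 → x ∈ K ∧ F x = k * s := by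
    intro s
    by_cases hs : s ∈ Ioc (0 : ℝ) 1
    swap
    · exact ⟨0, fun h ↦ absurd h hs⟩
    have hks : k * s ∈ Icc (F 0) (F (max R 0)) := by
      rw [hF0, hFR]
      exact ⟨mul_nonneg hpos.le hs.1.le, mul_le_of_le_one_right hpos.le hs.2⟩
    obtain ⟨r, hr, hFr⟩ := intermediate_value_Icc (le_max_right R 0) hcont.continuousOn hks
    have hne : (K ∩ Icc 0 r).Nonempty := by
      by_contra hne
      rw [not_nonempty_iff_eq_empty] at hne
      have : F r = 0 := by simp [hF, hne]
      rw [this] at hFr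
      exact (mul_pos hpos hs.1).ne hFr
    have hc : IsCompact (K ∩ Icc 0 r) := hK.inter_right isClosed_Icc
    obtain ⟨x, hx, hmax⟩ := hc.exists_isGreatest hne
    refine ⟨x, fun _ ↦ ⟨hx.1, ?_⟩⟩
    rw [← hFr]
    simp only [hF]
    congr 1
    ext y
    exact ⟨fun hy ↦ ⟨hy.1, hy.2.1, hy.2.2.trans hx.2.2⟩, fun hy ↦ ⟨hy.1, hy.2.1, hmax hy⟩⟩
  choose x hx using hex
  refine ⟨x, fun s hs ↦ (hx s hs).1, fun s hs ↦ ?_, fun s hs s' hs' h ↦ ?_⟩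
  · have := hstep 0 (x s) (hK0 (hx s hs).1)
    rw [hF0, (hx s hs).2] at this
    linarith
  · have hlt : x s < x s' := by
      by_contra hle
      have := hmono (not_lt.1 hle)
      rw [(hx s hs).2, (hx s' hs').2] at this
      exact absurd this (not_le.2 (by gcongr))
    have := hstep _ _ hlt.le
    rw [(hx s hs).2, (hx s' hs').2] at this
    linarith

/-- Brunn–Minkowski inequality on the half-line for the images of compact sets under a
weighted power mean. -/
lemma weightedMean_volume_le {A B α : ℝ} (hA : 0 < A) (hB : 0 < B) (hα : α ≤ 1)
    (h0 : α = 0 → A + B = 1) {K L S : Set ℝ} (hK : IsCompact K) (hL : IsCompact L)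
    (hK0 : K ⊆ Ici 0) (hL0 : L ⊆ Ici 0)
    (hKpos : 0 < volume.real K) (hLpos : 0 < volume.real L)
    (hS : ∀ x ∈ K, ∀ y ∈ L, 0 < x → 0 < y → weightedMean A B α x y ∈ S) :
    ENNReal.ofReal (weightedMean A B α (volume.real K) (volume.real L)) ≤ volume S := by
  obtain ⟨x, hxK, hxs, hx⟩ := exists_expanding_parametrization hK hK0 hKpos
  obtain ⟨y, hyL, hys, hy⟩ := exists_expanding_parametrization hL hL0 hLpos
  have hxpos : ∀ s ∈ Ioc (0 : ℝ) 1, 0 < x s := fun s hs ↦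
    (mul_pos hKpos hs.1).trans_le (hxs s hs)
  have hypos : ∀ s ∈ Ioc (0 : ℝ) 1, 0 < y s := fun s hs ↦
    (mul_pos hLpos hs.1).trans_le (hys s hs)
  refine ofReal_le_volume_of_expanding (z := fun s ↦ weightedMean A B α (x s) (y s))
    (weightedMean_pos hA hB hKpos hLpos) (fun s hs s' hs' h ↦ ?_)
    fun s hs ↦ hS _ (hxK s hs) _ (hyL s hs) (hxpos s hs) (hypos s hs)
  have hd : 0 < s' - s := sub_pos.2 h
  have hx0 := hxpos s hs
  have hy0 := hypos s hs
  rw [← weightedMean_smul hA hB hKpos hLpos h0 hd]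
  exact (weightedMean_add_le hA hB hα h0 hx0 hy0 (by positivity) (by positivity)).trans
    (weightedMean_mono hA hB (by positivity) (by positivity) (hx s hs s' hs' h)
      (hy s hs s' hs' h))

lemma Mp_eq_weightedMean {p t l α x y : ℝ} (hx : 0 < x) (hy : 0 < y) :
    Mp p t l α x y = weightedMean (Cc p t l) (Dd p t l) α x y := by
  rw [Mp, if_neg (mul_pos hx hy).ne', weightedMean]

lemma Mmean_eq_weightedMean {t α x y : ℝ} (hx : 0 < x) (hy : 0 < y) :
    Mmean t α x y = weightedMean (1 - t) t α x y := by
  rw [Mmean, if_neg (mul_pos hx hy).ne', weightedMean]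

section Coefficients

variable {p t l : ℝ}

lemma Cc_pos (ht : t ∈ Ioo (0 : ℝ) 1) (hl : l ∈ Ioo (0 : ℝ) 1) : 0 < Cc p t l :=
  mul_pos (Real.rpow_pos_of_pos (sub_pos.2 ht.2) _) (Real.rpow_pos_of_pos (sub_pos.2 hl.2) _)

lemma Dd_pos (ht : t ∈ Ioo (0 : ℝ) 1) (hl : l ∈ Ioo (0 : ℝ) 1) : 0 < Dd p t l :=
  mul_pos (Real.rpow_pos_of_pos ht.1 _) (Real.rpow_pos_of_pos hl.1 _)

lemma rpow_conjugate_self {r : ℝ} (hr : 0 < r) : r ^ (1 / p) * r ^ (1 - 1 / p) = r := by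
  rw [← Real.rpow_add hr, add_sub_cancel, Real.rpow_one]

lemma Cc_self (ht : t ∈ Ioo (0 : ℝ) 1) : Cc p t t = 1 - t :=
  rpow_conjugate_self (sub_pos.2 ht.2)

lemma Dd_self (ht : t ∈ Ioo (0 : ℝ) 1) : Dd p t t = t := rpow_conjugate_self ht.1

/-- A product `r ^ (1/p) * s ^ (1/q)` of powers of numbers in `(0, 1)` lies between `r * s`
and `1`. -/
lemma mul_le_rpow_conjugate_mul_le_one {r s : ℝ} (hp : 1 ≤ p) (hr : r ∈ Ioo (0 : ℝ) 1)
    (hs : s ∈ Ioo (0 : ℝ) 1) :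
    r * s ≤ r ^ (1 / p) * s ^ (1 - 1 / p) ∧ r ^ (1 / p) * s ^ (1 - 1 / p) ≤ 1 := by
  have h1 : 1 / p ≤ 1 := by rw [div_le_one (by linarith)]; exact hp
  have h0 : 0 ≤ 1 / p := by positivity
  constructor
  · have e1 := Real.rpow_le_rpow_of_exponent_ge hr.1 hr.2.le h1
    have e2 := Real.rpow_le_rpow_of_exponent_ge hs.1 hs.2.le (show 1 - 1 / p ≤ 1 by linarith)
    rw [Real.rpow_one] at e1 e2
    exact mul_le_mul e1 e2 hs.1.le (Real.rpow_nonneg hr.1.le _)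
  · exact mul_le_one₀ (Real.rpow_le_one hr.1.le hr.2.le h0) (Real.rpow_nonneg hs.1.le _)
      (Real.rpow_le_one hs.1.le hs.2.le (by linarith))

/-- The weights of `M_{p,α}` at the parameter at which Hölder's inequality is an equality. -/
lemma exists_Cc_mul_add_Dd_mul_eq (hp : 1 ≤ p) (ht : t ∈ Ioo (0 : ℝ) 1) {u v : ℝ}
    (hu : 0 < u) (hv : 0 < v) :
    ∃ l ∈ Ioo (0 : ℝ) 1,
      Cc p t l * u + Dd p t l * v = ((1 - t) * u ^ p + t * v ^ p) ^ (1 / p) := by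
  have ht0 := ht.1
  have ht1 : 0 < 1 - t := sub_pos.2 ht.2
  have hp0 : p ≠ 0 := by positivity
  set S := (1 - t) * u ^ p + t * v ^ p with hSdef
  have hS : 0 < S := by positivity
  have hterm (r w : ℝ) (hr : 0 < r) (hw : 0 < w) :
      r ^ (1 / p) * (r * w ^ p / S) ^ (1 - 1 / p) * w = r * w ^ p / S * S ^ (1 / p) := by
    have e1 : r ^ (1 / p) * w = (r * w ^ p) ^ (1 / p) := by
      rw [Real.mul_rpow hr.le (by positivity), ← Real.rpow_mul hw.le, mul_one_div_cancel hp0,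
        Real.rpow_one]
    have e2 : (r * w ^ p / S) ^ (1 / p) * S ^ (1 / p) = (r * w ^ p) ^ (1 / p) := by
      rw [← Real.mul_rpow (by positivity) hS.le, div_mul_cancel₀ _ hS.ne']
    have e3 := rpow_conjugate_self (p := p) (show 0 < r * w ^ p / S by positivity)
    linear_combination (r * w ^ p / S) ^ (1 - 1 / p) * (e1 - e2) + S ^ (1 / p) * e3
  have hl : 1 - t * v ^ p / S = (1 - t) * u ^ p / S := by
    field_simp
    rw [hSdef]; ring
  refine ⟨t * v ^ p / S, ⟨by positivity, ?_⟩, ?_⟩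
  · have : 0 < (1 - t) * u ^ p / S := by positivity
    linarith
  · rw [Cc, Dd, hl, hterm _ _ ht1 hu, hterm _ _ ht0 hv, ← add_mul, ← add_div, ← hSdef,
      div_self hS.ne', one_mul]

end Coefficients

/-- For `α ≤ 0` the power mean decreases when the exponent is multiplied by `p ≥ 1`. -/
lemma weightedMean_mul_exponent_le {p t α x y : ℝ} (hp : 1 ≤ p) (ht : t ∈ Ioo (0 : ℝ) 1)
    (hα : α ≤ 0) (hx : 0 < x) (hy : 0 < y) :
    weightedMean (1 - t) t (p * α) x y ≤ weightedMean (1 - t) t α x y := by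
  rcases hα.eq_or_lt with rfl | hα
  · simp
  have hp0 : 0 < p := by linarith
  have ht0 := ht.1
  have ht1 : 0 < 1 - t := sub_pos.2 ht.2
  rw [weightedMean, weightedMean, if_neg hα.ne, if_neg (mul_neg_of_pos_of_neg hp0 hα).ne]
  have h := (convexOn_rpow hp).2 (mem_Ici.2 (Real.rpow_nonneg hx.le α))
    (mem_Ici.2 (Real.rpow_nonneg hy.le α)) ht1.le ht0.le (by ring)
  simp only [smul_eq_mul, ← Real.rpow_mul hx.le, ← Real.rpow_mul hy.le] at h
  rw [mul_comm p α]
  have hexp : (1 : ℝ) / α = p * (1 / (α * p)) := by field_simp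
  rw [hexp, Real.rpow_mul (show 0 ≤ (1 - t) * x ^ α + t * y ^ α by positivity)]
  exact Real.rpow_le_rpow_of_nonpos (by positivity) h
    (one_div_nonpos.2 (mul_neg_of_neg_of_pos hα hp0).le)

/-- The means `M_{p,α}^{(t,λ)}` are bounded on bounded sets, uniformly in `λ`. -/
lemma exists_Mp_mem_Icc {p t : ℝ} (α R : ℝ) (hp : 1 ≤ p) (ht : t ∈ Ioo (0 : ℝ) 1) :
    ∃ N, ∀ l ∈ Ioo (0 : ℝ) 1, ∀ x ∈ Icc 0 R, ∀ y ∈ Icc 0 R, Mp p t l α x y ∈ Icc 0 N := by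
  have ht0 := ht.1
  have ht1 : 0 < 1 - t := sub_pos.2 ht.2
  set Q := max R 1
  have hQ1 : 1 ≤ Q := le_max_right _ _
  have hQ : 0 < Q := by linarith
  set N := if α = 0 then Q * Q else if 0 < α then (1 * Q ^ α + 1 * Q ^ α) ^ (1 / α)
    else ((1 - t) * t * Q ^ α) ^ (1 / α) with hN
  have hN0 : 0 ≤ N := by
    rw [hN]; split_ifs <;> positivity
  refine ⟨N, fun l hl x hx y hy ↦ ?_⟩
  by_cases hxy : x * y = 0
  · rw [Mp, if_pos hxy]
    exact ⟨le_rfl, hN0⟩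
  have hx0 : 0 < x := lt_of_le_of_ne hx.1 fun h ↦ hxy (by simp [← h])
  have hy0 : 0 < y := lt_of_le_of_ne hy.1 fun h ↦ hxy (by simp [← h])
  have hxQ : x ≤ Q := hx.2.trans (le_max_left _ _)
  have hyQ : y ≤ Q := hy.2.trans (le_max_left _ _)
  have ht' : 1 - t ∈ Ioo (0 : ℝ) 1 := ⟨ht1, by linarith⟩
  have hl' : 1 - l ∈ Ioo (0 : ℝ) 1 := ⟨sub_pos.2 hl.2, by linarith [hl.1]⟩
  obtain ⟨hC, hC1⟩ : _ ≤ Cc p t l ∧ Cc p t l ≤ 1 := mul_le_rpow_conjugate_mul_le_one hp ht' hl'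
  obtain ⟨hD, hD1⟩ : _ ≤ Dd p t l ∧ Dd p t l ≤ 1 := mul_le_rpow_conjugate_mul_le_one hp ht hl
  have hC0 := Cc_pos (p := p) ht hl
  have hD0 := Dd_pos (p := p) ht hl
  rw [Mp_eq_weightedMean hx0 hy0]
  refine ⟨(weightedMean_pos hC0 hD0 hx0 hy0).le,
    (weightedMean_mono hC0 hD0 hx0 hy0 hxQ hyQ).trans ?_⟩
  rw [hN, weightedMean]
  split_ifs with h h'
  · have e1 := Real.rpow_le_rpow_of_exponent_le hQ1 hC1
    have e2 := Real.rpow_le_rpow_of_exponent_le hQ1 hD1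
    rw [Real.rpow_one] at e1 e2
    gcongr
  · gcongr
  · refine Real.rpow_le_rpow_of_nonpos (by positivity) ?_ (one_div_nonpos.2 (not_lt.1 h'))
    rw [← add_mul]
    gcongr
    nlinarith [mul_pos ht0 hl.1, mul_pos ht1 hl'.1, mul_pos (mul_pos ht0 ht0) hl.1,
      mul_pos (mul_pos ht1 ht1) hl'.1]

lemma volume_curv1_lt_top {p t α : ℝ} (hp : 1 ≤ p) (ht : t ∈ Ioo (0 : ℝ) 1) {K L : Set ℝ}
    (hK : IsCompact K) (hL : IsCompact L) (hK0 : K ⊆ Ici 0) (hL0 : L ⊆ Ici 0) :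
    volume (curv1 p t α K L) < ⊤ := by
  obtain ⟨R, hR⟩ := (hK.union hL).bddAbove
  obtain ⟨N, hN⟩ := exists_Mp_mem_Icc α R hp ht
  refine (measure_mono (t := Icc 0 N) ?_).trans_lt measure_Icc_lt_top
  simp only [curv1, iUnion_subset_iff]
  rintro l hl _ ⟨x, hx, y, hy, rfl⟩
  exact hN l hl x ⟨hK0 hx, hR (Or.inl hx)⟩ y ⟨hL0 hy, hR (Or.inr hy)⟩

/-- Curvilinear Brunn–Minkowski inequality for compact subsets of the half-line. -/
lemma Mmean_volume_le_volume_curv1 {p t α : ℝ} (hp : 1 ≤ p) (ht : t ∈ Ioo (0 : ℝ) 1)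
    (hα : α ≤ 1) {K L : Set ℝ} (hK : IsCompact K) (hL : IsCompact L)
    (hK0 : K ⊆ Ici 0) (hL0 : L ⊆ Ici 0) :
    Mmean t (p * α) (volume.real K) (volume.real L) ≤ volume.real (curv1 p t α K L) := by
  by_cases hKL : volume.real K * volume.real L = 0
  · rw [Mmean, if_pos hKL]
    exact measureReal_nonneg
  have hk : 0 < volume.real K :=
    lt_of_le_of_ne measureReal_nonneg fun h ↦ hKL (by simp [← h])
  have hl : 0 < volume.real L :=
    lt_of_le_of_ne measureReal_nonneg fun h ↦ hKL (by simp [← h])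
  have key : ∀ l ∈ Ioo (0 : ℝ) 1, (α = 0 → Cc p t l + Dd p t l = 1) →
      weightedMean (Cc p t l) (Dd p t l) α (volume.real K) (volume.real L) ≤
        volume.real (curv1 p t α K L) := by
    intro l hl' h0
    refine (ENNReal.ofReal_le_iff_le_toReal (volume_curv1_lt_top hp ht hK hL hK0 hL0).ne).1 ?_
    refine weightedMean_volume_le (Cc_pos ht hl') (Dd_pos ht hl') hα h0 hK hL hK0 hL0 hk hl ?_
    intro x hx y hy hx0 hy0
    exact mem_biUnion hl' ⟨x, hx, y, hy, (Mp_eq_weightedMean hx0 hy0).symm⟩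
  rw [Mmean_eq_weightedMean hk hl]
  rcases le_or_gt α 0 with h | h
  · have := key t ht
    rw [Cc_self ht, Dd_self ht] at this
    exact (weightedMean_mul_exponent_le hp ht h hk hl).trans (this fun _ ↦ by ring)
  · obtain ⟨l, hl', heq⟩ := exists_Cc_mul_add_Dd_mul_eq hp ht
      (Real.rpow_pos_of_pos hk α) (Real.rpow_pos_of_pos hl α)
    refine le_trans (le_of_eq ?_) (key l hl' fun h' ↦ absurd h' h.ne')
    have ht0 := ht.1
    have ht1 : 0 < 1 - t := sub_pos.2 ht.2
    have hp0 : 0 < p := by linarith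
    rw [weightedMean, weightedMean, if_neg h.ne', if_neg (mul_pos hp0 h).ne', heq,
      ← Real.rpow_mul (by positivity), ← Real.rpow_mul hk.le, ← Real.rpow_mul hl.le,
      mul_comm α p, one_div_mul_one_div]

/-- one-dimensional `L_{p,α}`-curvilinear Brunn-Minkowski inequality for
finite unions of compact intervals with nonnegative endpoints and disjoint interiors. -/
theorem stmt_1 (p t α : ℝ) (hp : 1 ≤ p) (ht : t ∈ Set.Ioo (0:ℝ) 1) (hα : α ≤ 1)
    (m ν : ℕ) (a b : Fin m → ℝ) (c d : Fin ν → ℝ)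
    (hab : ∀ i, 0 ≤ a i ∧ a i ≤ b i) (hcd : ∀ j, 0 ≤ c j ∧ c j ≤ d j)
    (hKdisj : ∀ i j, i ≠ j → Disjoint (Set.Ioo (a i) (b i)) (Set.Ioo (a j) (b j)))
    (hLdisj : ∀ i j, i ≠ j → Disjoint (Set.Ioo (c i) (d i)) (Set.Ioo (c j) (d j)))
    (K L : Set ℝ)
    (hK : K = ⋃ i, Set.Icc (a i) (b i)) (hL : L = ⋃ j, Set.Icc (c j) (d j)) :
    (volume (curv1 p t α K L)).toReal ≥
      Mmean t (p * α) (volume K).toReal (volume L).toReal := by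
  have hcompact {n : ℕ} (r s : Fin n → ℝ) : IsCompact (⋃ i, Icc (r i) (s i)) :=
    isCompact_iUnion fun _ ↦ isCompact_Icc
  have hnonneg {n : ℕ} (r s : Fin n → ℝ) (h : ∀ i, 0 ≤ r i ∧ r i ≤ s i) :
      (⋃ i, Icc (r i) (s i)) ⊆ Ici 0 :=
    iUnion_subset fun i _ hx ↦ (h i).1.trans hx.1
  subst hK hL
  exact Mmean_volume_le_volume_curv1 hp ht hα (hcompact a b) (hcompact c d)
    (hnonneg a b hab) (hnonneg c d hcd)
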